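/- arXiv:cs/0410034 — 8 statements merged into one kernel-verified Lean document; each statement's English description precedes it below -/
import Mathlib

section
/- For all formulas A and B of second-order Light Linear Logic: if the sequent ⊢ (1 & A) ⊸ B is provable, then the sequent ⊢ (!1 ⊗ !A) ⊸ $B is provable. -/
namespace LLL

/-- Formulas of second-order Light Linear Logic.
`pv n` is the propositional variable α (de Bruijn index `n`),
`nv n` its dual α^⊥; `oc` is !, `wn` is ?, `pg` is the neutral modality $,
`fa`/`ex` are the second-order quantifiers (binding de Bruijn index 0). -/
inductive Fm : Type
  | pv : ℕ → Fm
  | nv : ℕ → Fm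
  | one : Fm
  | bot : Fm
  | tens : Fm → Fm → Fm
  | parr : Fm → Fm → Fm
  | wth : Fm → Fm → Fm
  | plus : Fm → Fm → Fm
  | oc : Fm → Fm
  | wn : Fm → Fm
  | pg : Fm → Fm
  | fa : Fm → Fm
  | ex : Fm → Fm

open Fm

/-- Linear negation, defined by De Morgan duality. -/
def dual : Fm → Fm
  | pv n => nv n
  | nv n => pv n
  | one => bot
  | bot => one
  | tens A B => parr (dual A) (dual B)
  | parr A B => tens (dual A) (dual B)
  | wth A B => plus (dual A) (dual B)
  | plus A B => wth (dual A) (dual B)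
  | oc A => wn (dual A)
  | wn A => oc (dual A)
  | pg A => pg (dual A)
  | fa A => ex (dual A)
  | ex A => fa (dual A)

/-- `shift c A` lifts every free variable of index `≥ c` by one. -/
def shift : ℕ → Fm → Fm
  | c, pv n => if n < c then pv n else pv (n+1)
  | c, nv n => if n < c then nv n else nv (n+1)
  | _, one => one
  | _, bot => bot
  | c, tens A B => tens (shift c A) (shift c B)
  | c, parr A B => parr (shift c A) (shift c B)
  | c, wth A B => wth (shift c A) (shift c B)
  | c, plus A B => plus (shift c A) (shift c B)
  | c, oc A => oc (shift c A)
  | c, wn A => wn (shift c A)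
  | c, pg A => pg (shift c A)
  | c, fa A => fa (shift (c+1) A)
  | c, ex A => ex (shift (c+1) A)

/-- `subst B k A` is A[B/α] where α is the variable of de Bruijn index `k`
(free variables above `k` are lowered accordingly). -/
def subst : Fm → ℕ → Fm → Fm
  | B, k, pv n => if n = k then B else if n < k then pv n else pv (n-1)
  | B, k, nv n => if n = k then dual B else if n < k then nv n else nv (n-1)
  | _, _, one => one
  | _, _, bot => bot
  | B, k, tens A C => tens (subst B k A) (subst B k C)
  | B, k, parr A C => parr (subst B k A) (subst B k C)
  | B, k, wth A C => wth (subst B k A) (subst B k C)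
  | B, k, plus A C => plus (subst B k A) (subst B k C)
  | B, k, oc A => oc (subst B k A)
  | B, k, wn A => wn (subst B k A)
  | B, k, pg A => pg (subst B k A)
  | B, k, fa A => fa (subst (shift 0 B) (k+1) A)
  | B, k, ex A => ex (subst (shift 0 B) (k+1) A)

/-- Linear implication A ⊸ B := A^⊥ ⅋ B. -/
def limp (A B : Fm) : Fm := parr (dual A) B

/-- Provability of one-sided sequents (finite multisets of formulas) in LLL.
The Boolean flag records whether the exponential rules
(of-course box, neutral box, ?-weakening, ?-contraction, door splitting)
may be used: `Prov true` is full LLL provability, while a `Prov false`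
derivation uses none of those five rules. -/
inductive Prov : Bool → Multiset Fm → Prop
  | id (b) (A : Fm) : Prov b {dual A, A}
  | cut {b} {Γ Δ : Multiset Fm} (A : Fm) :
      Prov b (A ::ₘ Γ) → Prov b (dual A ::ₘ Δ) → Prov b (Γ + Δ)
  | tens {b} {Γ Δ : Multiset Fm} {A B : Fm} :
      Prov b (A ::ₘ Γ) → Prov b (B ::ₘ Δ) → Prov b (Fm.tens A B ::ₘ (Γ + Δ))
  | parr {b} {Γ : Multiset Fm} {A B : Fm} :
      Prov b (A ::ₘ B ::ₘ Γ) → Prov b (Fm.parr A B ::ₘ Γ)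
  | one (b) : Prov b {Fm.one}
  | bot {b} {Γ : Multiset Fm} : Prov b Γ → Prov b (Fm.bot ::ₘ Γ)
  | wth {b} {Γ : Multiset Fm} {A B : Fm} :
      Prov b (A ::ₘ Γ) → Prov b (B ::ₘ Γ) → Prov b (Fm.wth A B ::ₘ Γ)
  | plus₁ {b} {Γ : Multiset Fm} {A B : Fm} :
      Prov b (A ::ₘ Γ) → Prov b (Fm.plus A B ::ₘ Γ)
  | plus₂ {b} {Γ : Multiset Fm} {A B : Fm} :
      Prov b (B ::ₘ Γ) → Prov b (Fm.plus A B ::ₘ Γ)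
  | fa {b} {Γ : Multiset Fm} {A : Fm} :
      Prov b (A ::ₘ Γ.map (shift 0)) → Prov b (Fm.fa A ::ₘ Γ)
  | ex {b} {Γ : Multiset Fm} {A : Fm} (B : Fm) :
      Prov b (subst B 0 A ::ₘ Γ) → Prov b (Fm.ex A ::ₘ Γ)
  | oc {A : Fm} : Prov true {A} → Prov true {Fm.oc A}
  | oc_aux {C A : Fm} : Prov true {C, A} → Prov true {Fm.wn C, Fm.oc A}
  | neutral {Γ Δ : Multiset Fm} :
      Prov true (Γ + Δ) → Prov true (Γ.map Fm.pg + Δ.map Fm.wn)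
  | wk {Γ : Multiset Fm} {A : Fm} : Prov true Γ → Prov true (Fm.wn A ::ₘ Γ)
  | ctr {Γ : Multiset Fm} {A : Fm} :
      Prov true (Fm.wn A ::ₘ Fm.wn A ::ₘ Γ) → Prov true (Fm.wn A ::ₘ Γ)
  | split {Γ : Multiset Fm} {A B : Fm} :
      Prov true (Fm.wn (Fm.plus A B) ::ₘ Γ) → Prov true (Fm.wn A ::ₘ Fm.wn B ::ₘ Γ)

/-- LLL provability. -/
def Provable (Γ : Multiset Fm) : Prop := Prov true Γ

/-- Provability with a derivation using none of the of-course box, neutral box,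
?-weakening, ?-contraction or door-splitting rules. -/
def ProvableNoBox (Γ : Multiset Fm) : Prop := Prov false Γ

/-- j-fold application of ?. -/
def wnIter : ℕ → Fm → Fm
  | 0, A => A
  | k+1, A => wn (wnIter k A)

/-- j-fold application of $. -/
def pgIter : ℕ → Fm → Fm
  | 0, A => A
  | k+1, A => pg (pgIter k A)

/-- `withChain A n` is the right-nested & of `n+1` copies of `A`. -/
def withChain (A : Fm) : ℕ → Fm
  | 0 => A
  | n+1 => wth A (withChain A n)

/-- `tensChain A n` is the right-nested ⊗ of `n+1` copies of `A`. -/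
def tensChain (A : Fm) : ℕ → Fm
  | 0 => A
  | n+1 => tens A (tensChain A n)

/-- bool^k := ∀X. (X & ⋯ & X) ⊸ X with k occurrences of X on the left (k ≥ 2). -/
def boolk (k : ℕ) : Fm := fa (limp (withChain (pv 0) (k-1)) (pv 0))

/-- bool := ∀X. (X & X) ⊸ X. -/
def bool' : Fm := boolk 2

/-- bint := ∀X. !(X⊸X) ⊸ (!(X⊸X) ⊸ $(X⊸X)). -/
def bint : Fm :=
  fa (limp (oc (limp (pv 0) (pv 0)))
      (limp (oc (limp (pv 0) (pv 0))) (pg (limp (pv 0) (pv 0)))))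

/-- tint := ∀X. !(X⊸X) ⊸ (!(X⊸X) ⊸ (!(X⊸X) ⊸ $(X⊸X))). -/
def tint : Fm :=
  fa (limp (oc (limp (pv 0) (pv 0)))
      (limp (oc (limp (pv 0) (pv 0)))
        (limp (oc (limp (pv 0) (pv 0))) (pg (limp (pv 0) (pv 0))))))

/-- config_q := ∀X. !(X⊸X) ⊸ (!(X⊸X) ⊸ (!(X⊸X) ⊸ $(X ⊸ (X ⊸ ((X⊗X) ⊗ bool^q))))). -/
def config (q : ℕ) : Fm :=
  fa (limp (oc (limp (pv 0) (pv 0)))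
      (limp (oc (limp (pv 0) (pv 0)))
        (limp (oc (limp (pv 0) (pv 0)))
          (pg (limp (pv 0)
            (limp (pv 0) (tens (tens (pv 0) (pv 0)) (boolk q))))))))

/-- Invertibility of the par rule for a lone formula. -/
theorem Prov.parr_inv {b : Bool} {X Y : Fm} (h : Prov b {Fm.parr X Y}) : Prov b {X, Y} := by
  have hX : Prov b (dual X ::ₘ {X}) := Prov.id b X
  have hY : Prov b (dual Y ::ₘ {Y}) := Prov.id b Y
  have hc : Prov b (0 + ({X} + {Y})) := Prov.cut (Fm.parr X Y) h (Prov.tens hX hY)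
  simpa using hc

/-- If ⊢ (1 & A) ⊸ B is provable in LLL, then ⊢ (!1 ⊗ !A) ⊸ $B is provable in LLL. -/
theorem lll_with_one_to_pg {A B : Fm}
    (h : Provable {limp (wth Fm.one A) B}) :
    Provable {limp (tens (oc Fm.one) (oc A)) (pg B)} := by
  have h₁ : Prov true ({B} + {Fm.plus Fm.bot (dual A)}) := by
    rw [add_comm]
    exact Prov.parr_inv h
  have h₂ : Prov true (Fm.wn (Fm.plus Fm.bot (dual A)) ::ₘ {Fm.pg B}) := by
    have hb := Prov.neutral h₁
    rw [Multiset.map_singleton, Multiset.map_singleton, add_comm] at hb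
    exact hb
  exact Prov.parr (Prov.parr (Prov.split h₂))

end LLL
end

section
/- For all formulas A and B of second-order Light Linear Logic, the sequent ⊢ (!A ⊗ !B) ⊸ !(A & B) is provable (Light Linear Logic retains the principle !A ⊗ !B ⊸ !(A & B)). -/
namespace LLL

open Fm

/-- LLL retains the principle !A ⊗ !B ⊸ !(A & B). -/
theorem lll_bang_tens_bang_limp_bang_with (A B : Fm) :
    Provable {limp (tens (oc A) (oc B)) (oc (wth A B))} := by
  exact Prov.parr (Γ := 0) (Prov.parr (Prov.split (Prov.oc_aux (Prov.id true (wth A B)))))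

end LLL
end

section
/- (⊥-coercion, a derived rule of LLL.) Let p ≥ 1, let k₁, …, k_p be natural numbers, and let k ≥ 1 be a natural number with k ≥ k_i for every 1 ≤ i ≤ p. For every finite multiset of formulas Γ: if ⊢ ?^{k₁}⊥, …, ?^{k_p}⊥, Γ is provable in LLL, then ⊢ ?^{k}⊥, Γ is provable in LLL. -/
namespace LLL

open Fm

theorem provable_pair_swap {A B : Fm} (h : Provable {A, B}) : Provable {B, A} := by
  rwa [Multiset.pair_comm]

/-- `⊢ (?^j ⊥)^⊥, ?^k ⊥` is provable whenever `j ≤ k`. -/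
theorem provable_dual_wnIter_bot :
    ∀ {j k : ℕ}, j ≤ k → Provable {dual (wnIter j Fm.bot), wnIter k Fm.bot}
  | 0, 0, _ => Prov.id true Fm.bot
  | 0, _ + 1, _ => provable_pair_swap (Prov.wk (Prov.one true))
  | _ + 1, _ + 1, hjk =>
    provable_pair_swap (Prov.oc_aux (provable_pair_swap
      (provable_dual_wnIter_bot (Nat.le_of_succ_le_succ hjk))))

/-- ⊥-coercion, a derived rule of LLL: for p ≥ 1 exponents k₁,…,k_p all bounded
by some k ≥ 1, from ⊢ ?^{k₁}⊥, …, ?^{k_p}⊥, Γ we get ⊢ ?^{k}⊥, Γ. -/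
theorem lll_bot_coercion (ks : Multiset ℕ) (hp : 1 ≤ Multiset.card ks)
    (k : ℕ) (hk1 : 1 ≤ k) (hk : ∀ i ∈ ks, i ≤ k) (Γ : Multiset Fm)
    (h : Provable (ks.map (fun j => wnIter j Fm.bot) + Γ)) :
    Provable (wnIter k Fm.bot ::ₘ Γ) := by
  obtain ⟨k, rfl⟩ := Nat.exists_eq_add_of_le' hk1
  clear hp
  induction ks using Multiset.induction generalizing Γ with
  | empty => exact Prov.wk (by simpa [Provable] using h)
  | cons j ks ih =>
    rw [Multiset.map_cons, Multiset.cons_add] at h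
    have hcut := Prov.cut _ h (provable_dual_wnIter_bot (hk j (Multiset.mem_cons_self j ks)))
    rw [add_assoc, add_comm Γ, Multiset.singleton_add] at hcut
    exact Prov.ctr (ih _ hcut (fun i hi => hk i (Multiset.mem_cons_of_mem hi)))

end LLL
end

section
/- (The comma of a discharged context denotes ⊕.) For every finite multiset of formulas Γ and all formulas A and B: the sequent ⊢ Γ, ?A, ?B is provable in LLL if and only if the sequent ⊢ Γ, ?(A ⊕ B) is provable in LLL. -/
namespace LLL

open Fm

/-- A discharged formula `?A` may be replaced by `?C` whenever `A ⊸ C` is provable: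
cut against the box `⊢ ?C, !A^⊥`. -/
theorem Prov.wn_mono {Γ : Multiset Fm} {A C : Fm} (hAC : Prov true {C, dual A})
    (h : Prov true (wn A ::ₘ Γ)) : Prov true (wn C ::ₘ Γ) := by
  have hbox : Prov true (dual (wn A) ::ₘ {wn C}) := by
    change Prov true {Fm.oc (dual A), wn C}
    rw [Multiset.pair_comm]
    exact Prov.oc_aux hAC
  have hcut := Prov.cut (wn A) h hbox
  rwa [add_comm, Multiset.singleton_add] at hcut

/-- The identity axiom with the two formulas exchanged. -/
theorem Prov.id_swap (b : Bool) (A : Fm) : Prov b {A, dual A} := by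
  rw [Multiset.pair_comm]
  exact Prov.id b A

/-- The comma of a discharged context denotes ⊕:
⊢ Γ, ?A, ?B is provable in LLL iff ⊢ Γ, ?(A ⊕ B) is. -/
theorem lll_discharged_comma_is_plus (Γ : Multiset Fm) (A B : Fm) :
    Provable (wn A ::ₘ wn B ::ₘ Γ) ↔ Provable (wn (plus A B) ::ₘ Γ) := by
  refine ⟨fun h => ?_, Prov.split⟩
  have hA := Prov.wn_mono (Prov.plus₁ (B := B) (Prov.id_swap true A)) h
  rw [Multiset.cons_swap] at hA
  exact Prov.ctr (Prov.wn_mono (Prov.plus₂ (A := A) (Prov.id_swap true B)) hA)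

end LLL
end

section
/- (The concatenation/addition badd on binary integers.) The sequent ⊢ bint^⊥, bint^⊥, bint is provable in LLL. -/
namespace LLL

open Fm

/-- The matrix of `dual bint`. -/
def dualBintBody : Fm :=
  tens (oc (parr (nv 0) (pv 0))) (tens (oc (parr (nv 0) (pv 0))) (pg (tens (pv 0) (nv 0))))

theorem Prov.of_eq {b : Bool} {Γ Δ : Multiset Fm} (h : Prov b Γ) (e : Γ = Δ) : Prov b Δ := e ▸ h

/-- Composition of two endomorphisms of `α`. -/
theorem prov_comp (b : Bool) :
    Prov b {tens (pv 0) (nv 0), tens (pv 0) (nv 0), parr (nv 0) (pv 0)} := by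
  have ax : Prov b (pv 0 ::ₘ {nv 0}) := (Prov.id b (pv 0)).of_eq (Multiset.pair_comm _ _)
  have ax' : Prov b (nv 0 ::ₘ {pv 0}) := Prov.id b (pv 0)
  have h₁ : Prov b (pv 0 ::ₘ {tens (pv 0) (nv 0), nv 0}) :=
    (Prov.tens ax ax').of_eq (by
      simp only [← Multiset.singleton_add, Multiset.insert_eq_cons]; abel)
  have h₂ : Prov b (nv 0 ::ₘ pv 0 ::ₘ {tens (pv 0) (nv 0), tens (pv 0) (nv 0)}) :=
    (Prov.tens h₁ ax').of_eq (by
      simp only [← Multiset.singleton_add, Multiset.insert_eq_cons]; abel)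
  exact h₂.parr.of_eq (by
    simp only [← Multiset.singleton_add, Multiset.insert_eq_cons]; abel)

/-- Instantiating a binary integer at `α` leaves two discharged step functions. -/
theorem prov_ex_dualBintBody {Γ : Multiset Fm} (h : Prov true (pg (tens (pv 0) (nv 0)) ::ₘ Γ)) :
    Prov true (ex dualBintBody ::ₘ wn (tens (pv 0) (nv 0)) ::ₘ wn (tens (pv 0) (nv 0)) ::ₘ Γ) := by
  have ax : Prov true (oc (parr (nv 0) (pv 0)) ::ₘ {wn (tens (pv 0) (nv 0))}) :=
    (Prov.id true (oc (parr (nv 0) (pv 0)))).of_eq (Multiset.pair_comm _ _)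
  refine Prov.ex (pv 0) ?_
  exact (Prov.tens ax (Prov.tens ax h)).of_eq (by
    change dualBintBody ::ₘ _ = dualBintBody ::ₘ _
    simp only [← Multiset.singleton_add])

/-- badd: concatenation/addition of binary integers, ⊢ bint^⊥, bint^⊥, bint. -/
theorem lll_badd : Provable {dual bint, dual bint, bint} := by
  let N := tens (pv 0) (nv 0)
  have core : Prov true (pg N ::ₘ pg N ::ₘ {pg (parr (nv 0) (pv 0))}) :=
    Prov.neutral (Δ := 0) ((prov_comp true).of_eq (add_zero _).symm)
  have h₁ := (prov_ex_dualBintBody core).of_eq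
    (Δ := pg N ::ₘ ex dualBintBody ::ₘ wn N ::ₘ wn N ::ₘ {pg (parr (nv 0) (pv 0))})
    (by simp only [← Multiset.singleton_add]; abel)
  have h₂ := ((prov_ex_dualBintBody h₁).of_eq
    (Δ := wn N ::ₘ wn N ::ₘ wn N ::ₘ wn N ::ₘ
      pg (parr (nv 0) (pv 0)) ::ₘ ex dualBintBody ::ₘ {ex dualBintBody})
    (by simp only [← Multiset.singleton_add]; abel)).ctr.ctr
  have h₃ := (h₂.of_eq
    (Δ := wn N ::ₘ pg (parr (nv 0) (pv 0)) ::ₘ wn N ::ₘ ex dualBintBody ::ₘ {ex dualBintBody})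
    (by simp only [← Multiset.singleton_add]; abel)).parr
  have h₄ := (h₃.of_eq (Multiset.cons_swap _ _ _)).parr
  have h₅ : Prov true (bint ::ₘ {dual bint, dual bint}) := Prov.fa h₄
  exact h₅.of_eq (by
    simp only [← Multiset.singleton_add, Multiset.insert_eq_cons]; abel)

end LLL
end

section
/- (The concatenation tadd on ternary integers.) The sequent ⊢ tint^⊥, tint^⊥, tint is provable in LLL. -/
namespace LLL

open Fm

/-- `(X ⊸ X)^⊥ = X ⊗ X^⊥` for the variable `X` of index 0. -/
def coEndo : Fm := tens (pv 0) (nv 0)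

/-- `X ⊸ X` for the variable `X` of index 0. -/
def endo : Fm := Fm.parr (nv 0) (pv 0)

/-- A ternary integer applied to three step functions yields its iterator under the neutral modality. -/
theorem prov_iterator :
    Prov true (dual tint ::ₘ {wn coEndo, wn coEndo, wn coEndo, pg endo}) := by
  have ho : Prov true (oc endo ::ₘ {wn coEndo}) :=
    (Prov.id true (oc endo)).of_eq (Multiset.pair_comm _ _)
  have hp : Prov true (pg coEndo ::ₘ {pg endo}) :=
    (Prov.id true (pg coEndo)).of_eq (Multiset.pair_comm _ _)
  exact Prov.ex (pv 0) (Prov.tens ho (Prov.tens ho (Prov.tens ho hp)))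

/-- Composition of two endomorphisms. -/
theorem prov_comp_s7 : Prov true {coEndo, coEndo, endo} := by
  have hid : Prov true (pv 0 ::ₘ {nv 0}) :=
    (Prov.id true (pv 0)).of_eq (Multiset.pair_comm _ _)
  have hid' : Prov true (nv 0 ::ₘ {pv 0}) := Prov.id true (pv 0)
  have h₁ : Prov true (coEndo ::ₘ ({nv 0} + {pv 0})) := Prov.tens hid hid'
  have h₂ : Prov true (pv 0 ::ₘ {coEndo, nv 0}) := by
    refine h₁.of_eq ?_
    simp only [← Multiset.singleton_add, Multiset.insert_eq_cons]
    abel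
  have h₃ : Prov true (coEndo ::ₘ ({coEndo, nv 0} + {pv 0})) := Prov.tens h₂ hid'
  have h₄ : Prov true (endo ::ₘ {coEndo, coEndo}) := by
    refine Prov.parr (h₃.of_eq ?_)
    simp only [← Multiset.singleton_add, Multiset.insert_eq_cons]
    abel
  refine h₄.of_eq ?_
  simp only [← Multiset.singleton_add, Multiset.insert_eq_cons]
  abel

/-- tadd: concatenation of ternary integers, ⊢ tint^⊥, tint^⊥, tint. -/
theorem lll_tadd : Provable {dual tint, dual tint, tint} := by
  have hcomp : Prov true (pg coEndo ::ₘ {pg coEndo, pg endo}) :=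
    Prov.neutral (Γ := {coEndo, coEndo, endo}) (Δ := 0) (prov_comp_s7.of_eq (add_zero _).symm)
  have hiter : Prov true (pg endo ::ₘ {dual tint, wn coEndo, wn coEndo, wn coEndo}) := by
    refine prov_iterator.of_eq ?_
    simp only [← Multiset.singleton_add, Multiset.insert_eq_cons]
    abel
  have hone := Prov.cut (pg endo) hiter hcomp
  have hone' : Prov true
      (pg coEndo ::ₘ {dual tint, wn coEndo, wn coEndo, wn coEndo, pg endo}) := by
    refine hone.of_eq ?_
    simp only [← Multiset.singleton_add, Multiset.insert_eq_cons]
    abel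
  have htwo := Prov.cut (pg endo) hiter hone'
  have hsix : Prov true (wn coEndo ::ₘ wn coEndo ::ₘ wn coEndo ::ₘ wn coEndo ::ₘ
      wn coEndo ::ₘ wn coEndo ::ₘ {pg endo, dual tint, dual tint}) := by
    refine htwo.of_eq ?_
    simp only [← Multiset.singleton_add, Multiset.insert_eq_cons]
    abel
  have hthree := Prov.ctr (Prov.ctr (Prov.ctr hsix))
  have hbody : Prov true
      (Fm.parr (wn coEndo) (Fm.parr (wn coEndo) (Fm.parr (wn coEndo) (pg endo))) ::ₘ
        {dual tint, dual tint}) := by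
    have h₁ := Prov.parr (Γ := {wn coEndo, wn coEndo, dual tint, dual tint})
      (A := wn coEndo) (B := pg endo) (hthree.of_eq (by
        simp only [← Multiset.singleton_add, Multiset.insert_eq_cons]
        abel))
    have h₂ := Prov.parr (Γ := {wn coEndo, dual tint, dual tint})
      (A := wn coEndo) (h₁.of_eq (Multiset.cons_swap _ _ _))
    exact Prov.parr (h₂.of_eq (Multiset.cons_swap _ _ _))
  have hfa : Prov true (tint ::ₘ {dual tint, dual tint}) := Prov.fa hbody
  refine hfa.of_eq ?_
  simp only [← Multiset.singleton_add, Multiset.insert_eq_cons]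
  abel

end LLL
end

section
/- (bint2config: every binary integer determines an initial Turing machine configuration.) For every q ≥ 2, the sequent ⊢ bint^⊥, config_q is provable in LLL. -/
namespace LLL

open Fm

/-- The first projection proves `X & ⋯ & X ⊸ X`. -/
theorem provable_dual_withChain (A : Fm) (n : ℕ) : Prov true {dual (withChain A n), A} := by
  cases n with
  | zero => exact Prov.id true A
  | succ n => exact Prov.plus₁ (Prov.id true A)

theorem provable_boolk (q : ℕ) : Prov true {boolk q} := by
  have h := Prov.parr (provable_dual_withChain (pv 0) (q - 1))
  exact Prov.fa (Γ := 0) h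

/-- A step function `A ⊸ A` followed by pairing with a provable `B`
turns two inputs of type `A` into `(A ⊗ A) ⊗ B`. -/
theorem provable_pair_of_step (n : ℕ) {B : Fm} (hB : Prov true {B}) :
    Prov true {tens (pv n) (nv n),
      limp (pv n) (limp (pv n) (tens (tens (pv n) (pv n)) B))} := by
  have hid : Prov true (pv n ::ₘ {nv n}) := by
    have h := Prov.id true (nv n)
    exact h
  have hpair : Prov true (tens (pv n) (pv n) ::ₘ ({nv n} + {nv n})) := Prov.tens hid hid
  have hout : Prov true (tens (tens (pv n) (pv n)) B ::ₘ (({nv n} + {nv n}) + 0)) :=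
    Prov.tens hpair hB
  have hout' : Prov true (nv n ::ₘ {nv n, tens (tens (pv n) (pv n)) B}) := by
    convert hout using 1
    simp only [Multiset.insert_eq_cons, ← Multiset.singleton_add]
    abel
  have hstep : Prov true (tens (pv n) (nv n) ::ₘ
      ({nv n} + {nv n, tens (tens (pv n) (pv n)) B})) := Prov.tens hid hout'
  have h₁ : Prov true (nv n ::ₘ tens (tens (pv n) (pv n)) B ::ₘ
      {nv n, tens (pv n) (nv n)}) := by
    convert hstep using 1
    simp only [Multiset.insert_eq_cons, ← Multiset.singleton_add]
    abel
  have h₂ : Prov true (nv n ::ₘ limp (pv n) (tens (tens (pv n) (pv n)) B) ::ₘ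
      {tens (pv n) (nv n)}) := by
    convert Prov.parr h₁ using 1
    exact Multiset.cons_swap _ _ _
  convert Prov.parr h₂ using 1
  exact Multiset.cons_swap _ _ _

/-- bint2config: every binary integer determines an initial configuration,
⊢ bint^⊥, config_q for every q ≥ 2. -/
theorem lll_bint2config (q : ℕ) (hq : 2 ≤ q) :
    Provable {dual bint, config q} := by
  let S : Fm := limp (pv 0) (pv 0)
  let R : Fm := limp (pv 0) (limp (pv 0) (tens (tens (pv 0) (pv 0)) (boolk q)))
  have hbox : Prov true (pg (dual S) ::ₘ {pg R}) :=
    Prov.neutral (Γ := {dual S, R}) (Δ := 0) (provable_pair_of_step 0 (provable_boolk q))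
  have hoc : Prov true (oc S ::ₘ {wn (dual S)}) := by
    convert Prov.id true (oc S) using 1
    exact Multiset.cons_swap _ _ _
  have hinst := Prov.tens hoc (Prov.tens hoc hbox)
  have hbint : Prov true (dual bint ::ₘ ({wn (dual S)} + ({wn (dual S)} + {pg R}))) :=
    Prov.ex (pv 0) hinst
  have hwk : Prov true (wn (dual S) ::ₘ pg R ::ₘ
      {wn (dual S), wn (dual S), dual bint}) := by
    convert Prov.wk (A := dual S) hbint using 1
    simp only [Multiset.insert_eq_cons, ← Multiset.singleton_add]
    abel
  have h₁ : Prov true (wn (dual S) ::ₘ limp (oc S) (pg R) ::ₘ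
      {wn (dual S), dual bint}) := by
    convert Prov.parr hwk using 1
    exact Multiset.cons_swap _ _ _
  have h₂ : Prov true (wn (dual S) ::ₘ limp (oc S) (limp (oc S) (pg R)) ::ₘ
      {dual bint}) := by
    convert Prov.parr h₁ using 1
    exact Multiset.cons_swap _ _ _
  have h₃ : Prov true (config q ::ₘ {dual bint}) :=
    Prov.fa (Γ := {dual bint}) (Prov.parr h₂)
  change Prov true (dual bint ::ₘ {config q})
  convert h₃ using 1
  exact Multiset.cons_swap _ _ _

end LLL
end

section
/- (The extract function; additive connectives and multiplicative constants make this possible.) For every formula A and every k ≥ 2, the sequent ⊢ T₁ ⊸ T₂ is provable in LLL, where id_A := A ⊸ A, T₁ := ((bool^4 & 1) ⊗ ((id_A & 1) ⊗ A)) ⊗ (((bool^4 & 1) ⊗ ((id_A & 1) ⊗ A)) ⊗ bool^k), and T₂ := ((((bool^4 ⊗ id_A) ⊗ A) ⊗ A) ⊗ bool^k). Moreover there is a proof that uses none of the of-course box, neutral box, ?-weakening, ?-contraction, or door-splitting rules. -/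
namespace LLL

open Fm

/-- The linear extraction: from two triples of optional resources keep one `B`, one `I`, both `A`s
and `K`, discarding the remaining options through the unit `1`. -/
theorem prov_extract (b : Bool) (A B I K : Fm) :
    Prov b {limp
      (tens (tens (wth B Fm.one) (tens (wth I Fm.one) A))
        (tens (tens (wth B Fm.one) (tens (wth I Fm.one) A)) K))
      (tens (tens (tens (tens B I) A) A) K)} := by
  have ax (C : Fm) : Prov b (C ::ₘ {dual C}) := by
    have h := Prov.id b C
    rwa [Multiset.pair_comm] at h
  have h := ((((ax B).tens (ax I)).tens (ax A)).tens (ax A)).tens (ax K)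
  set T := tens (tens (tens (tens B I) A) A) K
  have h₁ : Prov b (plus (dual B) bot ::ₘ {T, dual I, dual A, dual A, dual K}) :=
    Prov.plus₁ (by convert h using 1; simp only [Multiset.insert_eq_cons, ← Multiset.singleton_add]; abel)
  have h₂ : Prov b (plus (dual I) bot ::ₘ bot ::ₘ
      {T, plus (dual B) bot, dual A, dual A, dual K}) :=
    Prov.plus₁ (by convert h₁.bot using 1; simp only [Multiset.insert_eq_cons, ← Multiset.singleton_add]; abel)
  have h₃ : Prov b (plus (dual I) bot ::ₘ
      {T, plus (dual I) bot, plus (dual B) bot, dual A, dual A, dual K}) :=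
    Prov.plus₂ (by convert h₂ using 1; simp only [Multiset.insert_eq_cons, ← Multiset.singleton_add]; abel)
  have h₄ : Prov b (plus (dual B) bot ::ₘ
      {T, plus (dual I) bot, plus (dual I) bot, plus (dual B) bot, dual A, dual A, dual K}) :=
    Prov.plus₂ (by convert h₃.bot using 1; simp only [Multiset.insert_eq_cons, ← Multiset.singleton_add]; abel)
  have h₅ : Prov b (parr (plus (dual I) bot) (dual A) ::ₘ
      {T, plus (dual I) bot, plus (dual B) bot, plus (dual B) bot, dual A, dual K}) :=
    Prov.parr (by convert h₄ using 1; simp only [Multiset.insert_eq_cons, ← Multiset.singleton_add]; abel)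
  have h₆ : Prov b (parr (plus (dual I) bot) (dual A) ::ₘ
      {T, parr (plus (dual I) bot) (dual A), plus (dual B) bot, plus (dual B) bot, dual K}) :=
    Prov.parr (by convert h₅ using 1; simp only [Multiset.insert_eq_cons, ← Multiset.singleton_add]; abel)
  set P := parr (plus (dual I) bot) (dual A)
  have h₇ : Prov b (parr (plus (dual B) bot) P ::ₘ {T, P, plus (dual B) bot, dual K}) :=
    Prov.parr (by convert h₆ using 1; simp only [Multiset.insert_eq_cons, ← Multiset.singleton_add]; abel)
  have h₈ : Prov b (parr (plus (dual B) bot) P ::ₘ {T, parr (plus (dual B) bot) P, dual K}) :=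
    Prov.parr (by convert h₇ using 1; simp only [Multiset.insert_eq_cons, ← Multiset.singleton_add]; abel)
  set Q := parr (plus (dual B) bot) P
  have h₉ : Prov b (parr Q (dual K) ::ₘ {T, Q}) :=
    Prov.parr (by convert h₈ using 1; simp only [Multiset.insert_eq_cons, ← Multiset.singleton_add]; abel)
  have h₁₀ : Prov b (parr Q (parr Q (dual K)) ::ₘ {T}) :=
    Prov.parr (by convert h₉ using 1; simp only [Multiset.insert_eq_cons, ← Multiset.singleton_add]; abel)
  exact Prov.parr (Γ := 0) h₁₀

/-- The extract function: for every formula A and every k ≥ 2,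
⊢ T₁ ⊸ T₂ is provable in LLL, where id_A := A ⊸ A,
T₁ := ((bool⁴ & 1) ⊗ ((id_A & 1) ⊗ A)) ⊗ (((bool⁴ & 1) ⊗ ((id_A & 1) ⊗ A)) ⊗ bool^k)
and T₂ := (((bool⁴ ⊗ id_A) ⊗ A) ⊗ A) ⊗ bool^k; moreover some proof of it uses
none of the of-course box, neutral box, ?-weakening, ?-contraction or
door-splitting rules. -/
theorem lll_extract (A : Fm) (k : ℕ) (hk : 2 ≤ k) :
    Provable {limp
      (tens (tens (wth (boolk 4) Fm.one) (tens (wth (limp A A) Fm.one) A))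
        (tens (tens (wth (boolk 4) Fm.one) (tens (wth (limp A A) Fm.one) A))
          (boolk k)))
      (tens (tens (tens (tens (boolk 4) (limp A A)) A) A) (boolk k))} ∧
    ProvableNoBox {limp
      (tens (tens (wth (boolk 4) Fm.one) (tens (wth (limp A A) Fm.one) A))
        (tens (tens (wth (boolk 4) Fm.one) (tens (wth (limp A A) Fm.one) A))
          (boolk k)))
      (tens (tens (tens (tens (boolk 4) (limp A A)) A) A) (boolk k))} :=
  ⟨prov_extract true _ _ _ _, prov_extract false _ _ _ _⟩

end LLL
end
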